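/- Let m,n,p ≥ 3 and, over the three-letter alphabet {a,b,c}, let K₁ = L(X_m(a,b,−;{c})), K₂ = L(X_n(b,a,c;∅)), K₃ = L(X_p(b,−,c;{a})). Then the state complexity of K₁·(K₂ ∪ K₃) equals (m−1)·(2^{n+p} − 2^n − 2^p + 2) + 2^{n+p−2}. -/

import Mathlib

/-- The cyclic permutation `i ↦ i+1 mod n` on `{0,…,n−1}`. -/
def cyc {n : ℕ} (i : Fin n) : Fin n := ⟨(i.val + 1) % n, Nat.mod_lt _ i.pos⟩

/-- The transposition exchanging `0` and `1` and fixing all other elements of `{0,…,n−1}`. -/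
def transp {n : ℕ} (i : Fin n) : Fin n :=
  if i.val = 0 then ⟨1 % n, Nat.mod_lt _ i.pos⟩
  else if i.val = 1 then ⟨0, i.pos⟩ else i

/-- The contraction sending `1` to `0` and fixing all other elements of `{0,…,n−1}`. -/
def contr {n : ℕ} (i : Fin n) : Fin n := if i.val = 1 then ⟨0, i.pos⟩ else i

/-- A Brzozowski-type complete DFA: state set `{0,…,n−1}`, initial state `0`,
unique final state `n−1`, where each letter `x` acts as the transformation `f x`. -/
def brzDFA {α : Type} (n : ℕ) (hn : 0 < n) (f : α → Fin n → Fin n) : DFA α (Fin n) where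
  step q x := f x q
  start := ⟨0, hn⟩
  accept := {⟨n - 1, Nat.sub_lt hn Nat.one_pos⟩}

/-- The state complexity of a language: the least number of states of a complete
DFA recognizing it. -/
noncomputable def sc {α : Type} (L : Language α) : ℕ :=
  sInf {n | ∃ M : DFA α (Fin n), M.accepts = L}

/-- The three-letter alphabet `{a,b,c}`. -/
inductive ABC | a | b | c

/-- `X_m(a,b,−;{c})`: `a` the cycle, `b` the transposition, `c` the identity. -/
def XA (m : ℕ) (hm : 0 < m) : DFA ABC (Fin m) :=
  brzDFA m hm (fun x q => match x with | ABC.a => cyc q | ABC.b => transp q | ABC.c => q)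

/-- `X_n(b,a,c;∅)`: `b` the cycle, `a` the transposition, `c` the contraction. -/
def XB (n : ℕ) (hn : 0 < n) : DFA ABC (Fin n) :=
  brzDFA n hn (fun x q => match x with | ABC.a => transp q | ABC.b => cyc q | ABC.c => contr q)

/-- `X_p(b,−,c;{a})`: `b` the cycle, `c` the contraction, `a` the identity. -/
def XC (p : ℕ) (hp : 0 < p) : DFA ABC (Fin p) :=
  brzDFA p hp (fun x q => match x with | ABC.a => q | ABC.b => cyc q | ABC.c => contr q)

open Finset

theorem val_cyc_of_lt {n : ℕ} {i : Fin n} (h : i.val + 1 < n) : (cyc i).val = i.val + 1 :=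
  Nat.mod_eq_of_lt h

theorem val_cyc_of_eq {n : ℕ} {i : Fin n} (h : i.val + 1 = n) : (cyc i).val = 0 := by
  simp [cyc, h]

theorem val_cyc {n : ℕ} (i : Fin n) :
    (cyc i).val = if i.val + 1 = n then 0 else i.val + 1 := by
  split_ifs with h
  · exact val_cyc_of_eq h
  · exact val_cyc_of_lt (by omega)

theorem val_transp {n : ℕ} (hn : 2 ≤ n) (i : Fin n) :
    (transp i).val = if i.val = 0 then 1 else if i.val = 1 then 0 else i.val := by
  unfold transp
  split_ifs <;> simp [Nat.mod_eq_of_lt hn]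

theorem val_contr {n : ℕ} (i : Fin n) : (contr i).val = if i.val = 1 then 0 else i.val := by
  unfold contr
  split_ifs <;> simp

theorem contr_eq_iff {n : ℕ} {i j : Fin n} (hj : 2 ≤ j.val) : contr i = j ↔ i = j := by
  rw [Fin.ext_iff, Fin.ext_iff, val_contr]
  split_ifs <;> omega

theorem contr_ne {n : ℕ} {i j : Fin n} (hj : j.val = 1) : contr i ≠ j := by
  rw [Ne, Fin.ext_iff, val_contr]
  split_ifs <;> omega

theorem cyc_injective {n : ℕ} : Function.Injective (cyc : Fin n → Fin n) := by
  intro i j h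
  have h' := congrArg Fin.val h
  rw [val_cyc, val_cyc] at h'
  ext
  split_ifs at h' <;> omega

theorem transp_involutive {n : ℕ} (hn : 2 ≤ n) :
    Function.Involutive (transp : Fin n → Fin n) := by
  intro i
  ext
  rw [val_transp hn, val_transp hn]
  grind

/-- The cycle as a permutation. -/
noncomputable def cycPerm (n : ℕ) : Equiv.Perm (Fin n) :=
  Equiv.ofBijective cyc (Finite.injective_iff_bijective.mp cyc_injective)

/-- The transposition as a permutation. -/
def transpPerm {n : ℕ} (hn : 2 ≤ n) : Equiv.Perm (Fin n) := (transp_involutive hn).toPerm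

@[simp] theorem coe_cycPerm (n : ℕ) : ⇑(cycPerm n) = cyc := rfl

@[simp] theorem coe_transpPerm {n : ℕ} (hn : 2 ≤ n) : ⇑(transpPerm hn) = transp := rfl

theorem image_transp_image_transp {n : ℕ} (hn : 2 ≤ n) (S : Finset (Fin n)) :
    (S.image transp).image transp = S := by
  rw [image_image, (transp_involutive hn).comp_self, image_id]

section General

variable {α σ τ υ : Type} [DecidableEq τ] [DecidableEq υ]

/-- If the states in `V` are exactly the reachable ones and are pairwise distinguishable, then
the state complexity of the recognized language is the number of elements of `V`. -/
theorem sc_eq_card (M : DFA α σ) (V : Finset σ) (hstart : M.start ∈ V)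
    (hstep : ∀ s ∈ V, ∀ x, M.step s x ∈ V) (hreach : ∀ s ∈ V, ∃ w, M.eval w = s)
    (hdist : ∀ s ∈ V, ∀ t ∈ V, s ≠ t →
      ∃ w, ¬(M.evalFrom s w ∈ M.accept ↔ M.evalFrom t w ∈ M.accept)) :
    sc M.accepts = V.card := by
  have hdfa : ∃ N : DFA α (Fin V.card), N.accepts = M.accepts := by
    let N : DFA α V :=
      { step := fun s x => ⟨M.step s x, hstep s s.2 x⟩
        start := ⟨M.start, hstart⟩
        accept := {s | s.1 ∈ M.accept} }
    have hN : ∀ w (s : V), (N.evalFrom s w).1 = M.evalFrom s.1 w := by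
      intro w
      induction w with
      | nil => intro s; rfl
      | cons x w ih => intro s; exact ih _
    refine ⟨N.reindex V.equivFin, ?_⟩
    rw [DFA.accepts_reindex]
    ext w
    change (N.evalFrom _ w).1 ∈ M.accept ↔ _
    rw [hN]
    rfl
  refine le_antisymm (Nat.sInf_le hdfa) (le_csInf ⟨_, hdfa⟩ ?_)
  rintro k ⟨N, hN⟩
  choose f hf using hreach
  have hinj : Function.Injective (fun s : V => N.eval (f s s.2)) := by
    intro s t hst
    by_contra hne
    obtain ⟨w, hw⟩ := hdist s s.2 t t.2 (fun h => hne (Subtype.ext h))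
    apply hw
    have key : ∀ u : V, M.evalFrom u w ∈ M.accept ↔
        N.evalFrom (N.eval (f u u.2)) w ∈ N.accept := by
      intro u
      have h : f u u.2 ++ w ∈ N.accepts ↔ f u u.2 ++ w ∈ M.accepts := by rw [hN]
      rw [DFA.mem_accepts, DFA.mem_accepts, DFA.eval, DFA.evalFrom_of_append, DFA.eval,
        DFA.evalFrom_of_append] at h
      have h' := hf u u.2
      rw [DFA.eval] at h'
      rw [h'] at h
      exact h.symm
    rw [key s, key t]
    simp only at hst
    rw [hst]
  simpa using Fintype.card_le_of_injective _ hinj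

open Classical in
/-- The subset automaton recognizing `A.accepts * (B.accepts ⊔ C.accepts)`, when the initial state
of `A` is not accepting. -/
noncomputable def concatUnionDFA (A : DFA α σ) (B : DFA α τ) (C : DFA α υ) :
    DFA α (σ × Finset τ × Finset υ) where
  step s x :=
    if A.step s.1 x ∈ A.accept then
      (A.step s.1 x, insert B.start (s.2.1.image (B.step · x)),
        insert C.start (s.2.2.image (C.step · x)))
    else (A.step s.1 x, s.2.1.image (B.step · x), s.2.2.image (C.step · x))
  start := (A.start, ∅, ∅)
  accept := {s | (∃ i ∈ s.2.1, i ∈ B.accept) ∨ ∃ i ∈ s.2.2, i ∈ C.accept}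

theorem concatUnionDFA_step_of_mem (A : DFA α σ) (B : DFA α τ) (C : DFA α υ)
    {s : σ × Finset τ × Finset υ} {x : α} (h : A.step s.1 x ∈ A.accept) :
    (concatUnionDFA A B C).step s x =
      (A.step s.1 x, insert B.start (s.2.1.image (B.step · x)),
        insert C.start (s.2.2.image (C.step · x))) :=
  if_pos h

theorem concatUnionDFA_step_of_notMem (A : DFA α σ) (B : DFA α τ) (C : DFA α υ)
    {s : σ × Finset τ × Finset υ} {x : α} (h : A.step s.1 x ∉ A.accept) :
    (concatUnionDFA A B C).step s x =
      (A.step s.1 x, s.2.1.image (B.step · x), s.2.2.image (C.step · x)) :=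
  if_neg h

theorem exists_append_singleton_iff {Q : List α → List α → Prop} (w : List α) (x : α) :
    (∃ u v, u ++ v = w ++ [x] ∧ Q u v) ↔
      Q (w ++ [x]) [] ∨ ∃ u v, u ++ v = w ∧ Q u (v ++ [x]) := by
  constructor
  · rintro ⟨u, v, h, hQ⟩
    rcases List.eq_nil_or_concat v with rfl | ⟨v, y, rfl⟩
    · left
      rw [List.append_nil] at h
      exact h ▸ hQ
    · right
      rw [List.concat_eq_append, ← List.append_assoc] at h
      obtain ⟨h1, h2⟩ := List.append_inj' h rfl
      obtain rfl : y = x := by simpa using h2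
      exact ⟨u, v, h1, by simpa using hQ⟩
  · rintro (h | ⟨u, v, rfl, h⟩)
    · exact ⟨_, [], by simp, h⟩
    · exact ⟨u, v ++ [x], by simp, h⟩

theorem concatUnionDFA_eval (A : DFA α σ) (B : DFA α τ) (C : DFA α υ) (hA : A.start ∉ A.accept)
    (w : List α) :
    ((concatUnionDFA A B C).eval w).1 = A.eval w ∧
    (∀ i, i ∈ ((concatUnionDFA A B C).eval w).2.1 ↔
      ∃ u v, u ++ v = w ∧ A.eval u ∈ A.accept ∧ B.eval v = i) ∧
    (∀ i, i ∈ ((concatUnionDFA A B C).eval w).2.2 ↔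
      ∃ u v, u ++ v = w ∧ A.eval u ∈ A.accept ∧ C.eval v = i) := by
  induction w using List.reverseRecOn with
  | nil =>
    refine ⟨rfl, fun i => ?_, fun i => ?_⟩ <;>
    · constructor
      · intro h
        exact absurd h (Finset.notMem_empty i)
      · rintro ⟨u, v, h, hu, -⟩
        obtain ⟨rfl, rfl⟩ := List.append_eq_nil_iff.mp h
        exact absurd hu hA
  | append_singleton w x ih =>
    obtain ⟨h1, h2, h3⟩ := ih
    rw [DFA.eval_append_singleton, DFA.eval_append_singleton]
    generalize (concatUnionDFA A B C).eval w = s at h1 h2 h3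
    simp only [exists_append_singleton_iff, DFA.eval_append_singleton, DFA.eval_nil, ← h1]
    have e2 : ∀ i, i ∈ s.2.1.image (B.step · x) ↔
        ∃ u v, u ++ v = w ∧ A.eval u ∈ A.accept ∧ B.step (B.eval v) x = i := by
      intro i
      simp only [Finset.mem_image, h2]
      constructor
      · rintro ⟨_, ⟨u, v, h, hu, rfl⟩, hi⟩
        exact ⟨u, v, h, hu, hi⟩
      · rintro ⟨u, v, h, hu, hi⟩
        exact ⟨_, ⟨u, v, h, hu, rfl⟩, hi⟩
    have e3 : ∀ i, i ∈ s.2.2.image (C.step · x) ↔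
        ∃ u v, u ++ v = w ∧ A.eval u ∈ A.accept ∧ C.step (C.eval v) x = i := by
      intro i
      simp only [Finset.mem_image, h3]
      constructor
      · rintro ⟨_, ⟨u, v, h, hu, rfl⟩, hi⟩
        exact ⟨u, v, h, hu, hi⟩
      · rintro ⟨u, v, h, hu, hi⟩
        exact ⟨_, ⟨u, v, h, hu, rfl⟩, hi⟩
    by_cases hacc : A.step s.1 x ∈ A.accept
    · rw [concatUnionDFA_step_of_mem A B C hacc]
      simp only [Finset.mem_insert, e2, e3, hacc, true_and]
      exact ⟨fun i => or_congr eq_comm Iff.rfl, fun i => or_congr eq_comm Iff.rfl⟩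
    · rw [concatUnionDFA_step_of_notMem A B C hacc]
      simp only [e2, e3, hacc, false_and, false_or, implies_true, and_self]

theorem concatUnionDFA_accepts (A : DFA α σ) (B : DFA α τ) (C : DFA α υ)
    (hA : A.start ∉ A.accept) :
    (concatUnionDFA A B C).accepts = A.accepts * (B.accepts ⊔ C.accepts) := by
  ext w
  obtain ⟨-, h2, h3⟩ := concatUnionDFA_eval A B C hA w
  rw [DFA.mem_accepts, Language.mem_mul]
  change ((∃ i ∈ _, _) ∨ ∃ i ∈ _, _) ↔ ∃ u ∈ A.accepts, ∃ v, (v ∈ B.accepts ∨ v ∈ C.accepts) ∧ _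
  simp only [h2, h3, DFA.mem_accepts]
  constructor
  · rintro (⟨_, ⟨u, v, h, hu, rfl⟩, hi⟩ | ⟨_, ⟨u, v, h, hu, rfl⟩, hi⟩)
    · exact ⟨u, hu, v, Or.inl hi, h⟩
    · exact ⟨u, hu, v, Or.inr hi, h⟩
  · rintro ⟨u, hu, v, hi | hi, h⟩
    · exact Or.inl ⟨_, ⟨u, v, h, hu, rfl⟩, hi⟩
    · exact Or.inr ⟨_, ⟨u, v, h, hu, rfl⟩, hi⟩

/-- Two states are distinguishable if some word leads exactly one of them to acceptance. -/
def Distinguishable (M : DFA α σ) (s t : σ) : Prop :=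
  ∃ w, ¬(M.evalFrom s w ∈ M.accept ↔ M.evalFrom t w ∈ M.accept)

theorem Distinguishable.symm {M : DFA α σ} {s t : σ} (h : Distinguishable M s t) :
    Distinguishable M t s :=
  h.imp fun _ hw h' => hw h'.symm

theorem Distinguishable.of_step {M : DFA α σ} {s t : σ} (x : α)
    (h : Distinguishable M (M.step s x) (M.step t x)) : Distinguishable M s t :=
  let ⟨w, hw⟩ := h
  ⟨x :: w, hw⟩

theorem Distinguishable.of_evalFrom {M : DFA α σ} {s t : σ} (w : List α)
    (h : Distinguishable M (M.evalFrom s w) (M.evalFrom t w)) : Distinguishable M s t := by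
  obtain ⟨v, hv⟩ := h
  refine ⟨w ++ v, ?_⟩
  rwa [DFA.evalFrom_of_append, DFA.evalFrom_of_append]

end General

section PairAction

variable {n p : ℕ}

/-- A group of pairs of permutations containing `(ρσ, ρ)` and `(σρ, ρ)`, where `ρ` is the cycle and
`σ` the transposition, acts transitively on pairs of points. -/
theorem exists_mem_apply_eq (hn : 2 < n) (H : Subgroup (Equiv.Perm (Fin n) × Equiv.Perm (Fin p)))
    (hX : (cycPerm n * transpPerm (by omega : 2 ≤ n), cycPerm p) ∈ H)
    (hY : (transpPerm (by omega : 2 ≤ n) * cycPerm n, cycPerm p) ∈ H)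
    (s s' : Fin n) (t t' : Fin p) : ∃ g ∈ H, g.1 s = s' ∧ g.2 t = t' := by
  have hn2 : 2 ≤ n := by omega
  let one : Fin n := ⟨1, by omega⟩
  let zero : Fin p := ⟨0, t.pos⟩
  let Q : Fin n → Fin p → Prop := fun s t => ∃ g ∈ H, g.1 s = one ∧ g.2 t = zero
  have hQ : ∀ x ∈ H, ∀ s t, Q (x.1 s) (x.2 t) → Q s t := by
    rintro x hx s t ⟨g, hg, h1, h2⟩
    exact ⟨g * x, H.mul_mem hg hx, h1, h2⟩
  have hQone : ∀ k, ∀ t : Fin p, p - t.val ≤ k → Q one t := by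
    intro k
    induction k with
    | zero => intro t ht; omega
    | succ k ih =>
      intro t ht
      refine hQ _ hX _ _ ?_
      have h1 : (cycPerm n * transpPerm hn2) one = one := by
        ext
        simp [one, val_cyc, val_transp hn2]
        omega
      simp only [h1]
      by_cases h : t.val + 1 = p
      · exact ⟨1, H.one_mem, rfl, Fin.ext (val_cyc_of_eq h)⟩
      · refine ih _ ?_
        rw [coe_cycPerm, val_cyc_of_lt (by omega)]
        omega
  have hQtwo : ∀ k, ∀ (s : Fin n) (t : Fin p), 2 ≤ s.val → n - s.val ≤ k → Q s t := by
    intro k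
    induction k with
    | zero => intro s t _ hs; omega
    | succ k ih =>
      intro s t h2 hs
      by_cases h : s.val + 1 = n
      · refine hQ _ hY _ _ ?_
        have h1 : (transpPerm hn2 * cycPerm n) s = one := by
          ext
          simp [one, val_cyc, val_transp hn2, h]
        simp only [h1]
        exact hQone _ _ le_rfl
      · refine hQ _ hX _ _ ?_
        have h1 : ((cycPerm n * transpPerm hn2) s).val = s.val + 1 := by
          have h3 : transp s = s := by
            ext
            rw [val_transp hn2]
            split_ifs <;> omega
          simp only [Equiv.Perm.coe_mul, Function.comp_apply, coe_cycPerm, coe_transpPerm, h3]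
          exact val_cyc_of_lt (by omega)
        refine ih _ _ ?_ ?_ <;> simp only [h1] <;> omega
  have hQall : ∀ s t, Q s t := by
    intro s t
    rcases (by omega : s.val = 0 ∨ s.val = 1 ∨ 2 ≤ s.val) with h | h | h
    · let l : Fin n := ⟨n - 1, by omega⟩
      refine hQ _ (H.inv_mem hX) _ _ ?_
      have h1 : (cycPerm n * transpPerm hn2)⁻¹ s = l := by
        rw [Equiv.Perm.inv_eq_iff_eq]
        ext
        simp [l, val_cyc, val_transp hn2, h]
        grind
      simp only [Prod.fst_inv, h1]
      exact hQtwo _ _ _ (by simp only [l]; omega) le_rfl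
    · obtain rfl : s = one := Fin.ext h
      exact hQone _ _ le_rfl
    · exact hQtwo _ _ _ h le_rfl
  obtain ⟨g, hg, h1, h2⟩ := hQall s t
  obtain ⟨g', hg', h1', h2'⟩ := hQall s' t'
  refine ⟨g'⁻¹ * g, H.mul_mem (H.inv_mem hg') hg, ?_, ?_⟩
  · change g'.1.symm (g.1 s) = s'
    rw [h1, ← h1', Equiv.symm_apply_apply]
  · change g'.2.symm (g.2 t) = t'
    rw [h2, ← h2', Equiv.symm_apply_apply]

end PairAction

theorem mem_XA_accept {m : ℕ} (hm : 0 < m) (q : Fin m) :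
    q ∈ (XA m hm).accept ↔ q.val + 1 = m := by
  change q = _ ↔ _
  rw [Fin.ext_iff]
  simp only
  omega

section Steps

variable {m n p : ℕ}

/-- The subset automaton for `K₁·(K₂ ∪ K₃)`. -/
noncomputable def subsetDFA (hm : 2 < m) (hn : 2 < n) (hp : 2 < p) :
    DFA ABC (Fin m × Finset (Fin n) × Finset (Fin p)) :=
  concatUnionDFA (XA m (by omega)) (XB n (by omega)) (XC p (by omega))

variable (hm : 2 < m) (hn : 2 < n) (hp : 2 < p)

theorem subsetDFA_accepts : (subsetDFA hm hn hp).accepts =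
    (XA m (by omega)).accepts * ((XB n (by omega)).accepts ⊔ (XC p (by omega)).accepts) := by
  apply concatUnionDFA_accepts
  rw [mem_XA_accept]
  change ¬ 0 + 1 = m
  omega

theorem mem_subsetDFA_accept (s : Fin m × Finset (Fin n) × Finset (Fin p)) :
    s ∈ (subsetDFA hm hn hp).accept ↔
      (⟨n - 1, by omega⟩ : Fin n) ∈ s.2.1 ∨ (⟨p - 1, by omega⟩ : Fin p) ∈ s.2.2 := by
  change ((∃ i ∈ s.2.1, i = (⟨n - 1, _⟩ : Fin n)) ∨ ∃ i ∈ s.2.2, i = (⟨p - 1, _⟩ : Fin p)) ↔ _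
  simp

variable {q q' : Fin m} {S : Finset (Fin n)} {T : Finset (Fin p)}

theorem step_of_ne {x : ABC} (h : (XA m (by omega)).step q x = q') (h' : q'.val + 1 ≠ m) :
    (subsetDFA hm hn hp).step (q, S, T) x =
      (q', S.image ((XB n (by omega)).step · x), T.image ((XC p (by omega)).step · x)) := by
  subst h
  exact concatUnionDFA_step_of_notMem _ _ _ (fun h => h' ((mem_XA_accept _ _).mp h))

theorem step_of_eq {x : ABC} (h : (XA m (by omega)).step q x = q') (h' : q'.val + 1 = m) :
    (subsetDFA hm hn hp).step (q, S, T) x =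
      (q', insert ⟨0, by omega⟩ (S.image ((XB n (by omega)).step · x)),
        insert ⟨0, by omega⟩ (T.image ((XC p (by omega)).step · x))) := by
  subst h
  exact concatUnionDFA_step_of_mem _ _ _ ((mem_XA_accept _ _).mpr h')

theorem step_a (h : q'.val = q.val + 1) (h' : q'.val + 1 ≠ m) :
    (subsetDFA hm hn hp).step (q, S, T) ABC.a = (q', S.image transp, T) := by
  have hq : (XA m (by omega)).step q ABC.a = q' := by
    change cyc q = q'
    ext
    rw [val_cyc_of_lt (by omega), h]
  rw [step_of_ne hm hn hp hq h']
  congr 2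
  exact image_id

theorem step_a_to_last (h : q'.val = q.val + 1) (h' : q'.val + 1 = m) :
    (subsetDFA hm hn hp).step (q, S, T) ABC.a =
      (q', insert ⟨0, by omega⟩ (S.image transp), insert ⟨0, by omega⟩ T) := by
  have hq : (XA m (by omega)).step q ABC.a = q' := by
    change cyc q = q'
    ext
    rw [val_cyc_of_lt (by omega), h]
  rw [step_of_eq hm hn hp hq h']
  congr 3
  exact image_id

theorem step_a_of_last (h : q.val + 1 = m) (h' : q'.val = 0) :
    (subsetDFA hm hn hp).step (q, S, T) ABC.a = (q', S.image transp, T) := by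
  have hq : (XA m (by omega)).step q ABC.a = q' := by
    change cyc q = q'
    ext
    rw [val_cyc_of_eq h, h']
  rw [step_of_ne hm hn hp hq (by omega)]
  congr 2
  exact image_id

theorem step_b_of_le_one (h : q.val ≤ 1) (h' : q'.val = 1 - q.val) :
    (subsetDFA hm hn hp).step (q, S, T) ABC.b = (q', S.image cyc, T.image cyc) := by
  have hq : (XA m (by omega)).step q ABC.b = q' := by
    change transp q = q'
    ext
    rw [val_transp (by omega)]
    split_ifs <;> omega
  exact step_of_ne hm hn hp hq (by omega)

theorem step_b_of_two_le (h : 2 ≤ q.val) (h' : q.val + 1 ≠ m) :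
    (subsetDFA hm hn hp).step (q, S, T) ABC.b = (q, S.image cyc, T.image cyc) := by
  have hq : (XA m (by omega)).step q ABC.b = q := by
    change transp q = q
    ext
    rw [val_transp (by omega)]
    split_ifs <;> omega
  exact step_of_ne hm hn hp hq h'

theorem step_b_of_last (h : q.val + 1 = m) :
    (subsetDFA hm hn hp).step (q, S, T) ABC.b =
      (q, insert ⟨0, by omega⟩ (S.image cyc), insert ⟨0, by omega⟩ (T.image cyc)) := by
  have hq : (XA m (by omega)).step q ABC.b = q := by
    change transp q = q
    ext
    rw [val_transp (by omega)]
    split_ifs <;> omega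
  exact step_of_eq hm hn hp hq h

theorem step_c (h : q.val + 1 ≠ m) :
    (subsetDFA hm hn hp).step (q, S, T) ABC.c = (q, S.image contr, T.image contr) :=
  step_of_ne hm hn hp rfl h

theorem step_c_of_last (h : q.val + 1 = m) :
    (subsetDFA hm hn hp).step (q, S, T) ABC.c =
      (q, insert ⟨0, by omega⟩ (S.image contr), insert ⟨0, by omega⟩ (T.image contr)) :=
  step_of_eq hm hn hp rfl h

/-- The pairs of permutations induced on the last two components by the words looping at the initial
state of the first automaton. -/
def loopSubmonoid : Submonoid (Equiv.Perm (Fin n) × Equiv.Perm (Fin p)) where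
  carrier := {g | ∃ w, ∀ S T, (subsetDFA hm hn hp).evalFrom (⟨0, by omega⟩, S, T) w =
    (⟨0, by omega⟩, S.image g.1, T.image g.2)}
  one_mem' := ⟨[], fun S T => by simp⟩
  mul_mem' := by
    rintro g h ⟨u, hu⟩ ⟨v, hv⟩
    refine ⟨v ++ u, fun S T => ?_⟩
    rw [DFA.evalFrom_of_append, hv, hu, image_image, image_image]
    rfl

/-- `loopSubmonoid` as a subgroup. -/
def loopSubgroup : Subgroup (Equiv.Perm (Fin n) × Equiv.Perm (Fin p)) where
  __ := loopSubmonoid hm hn hp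
  inv_mem' := by
    intro g hg
    have h : g⁻¹ ∈ Submonoid.powers g :=
      mem_powers_iff_mem_zpowers.mpr (inv_mem (Subgroup.mem_zpowers g))
    exact Submonoid.powers_le.mpr (show g ∈ loopSubmonoid hm hn hp from hg) h

theorem exists_loop_apply_eq (s s' : Fin n) (t t' : Fin p) :
    ∃ g ∈ loopSubgroup hm hn hp, g.1 s = s' ∧ g.2 t = t' := by
  have hn2 : 2 ≤ n := by omega
  let q₀ : Fin m := ⟨0, by omega⟩
  let q₁ : Fin m := ⟨1, by omega⟩
  have hX : (cycPerm n * transpPerm hn2, cycPerm p) ∈ loopSubgroup hm hn hp := by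
    refine ⟨[ABC.a, ABC.b], fun S T => ?_⟩
    rw [DFA.evalFrom_cons, DFA.evalFrom_singleton, step_a hm hn hp (q' := q₁) rfl
      (by simp only [q₁]; omega), step_b_of_le_one hm hn hp (q' := q₀) le_rfl rfl, image_image]
    rfl
  have hZ : (cycPerm n * cycPerm n, cycPerm p * cycPerm p) ∈ loopSubgroup hm hn hp := by
    refine ⟨[ABC.b, ABC.b], fun S T => ?_⟩
    rw [DFA.evalFrom_cons, DFA.evalFrom_singleton, step_b_of_le_one hm hn hp (q := q₀) (q' := q₁)
      (Nat.zero_le 1) rfl, step_b_of_le_one hm hn hp (q' := q₀) le_rfl rfl, image_image,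
      image_image]
    rfl
  have hσ : (transpPerm hn2)⁻¹ = transpPerm hn2 := rfl
  have hY : (transpPerm hn2 * cycPerm n, cycPerm p) ∈ loopSubgroup hm hn hp := by
    have h := mul_mem (inv_mem hX) hZ
    simpa [mul_assoc, hσ] using h
  exact exists_mem_apply_eq hn _ hX hY s s' t t'

theorem exists_eval_step {s : Fin m × Finset (Fin n) × Finset (Fin p)} (x : ABC)
    (h : ∃ w, (subsetDFA hm hn hp).eval w = s) :
    ∃ w, (subsetDFA hm hn hp).eval w = (subsetDFA hm hn hp).step s x := by
  obtain ⟨w, rfl⟩ := h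
  exact ⟨w ++ [x], DFA.eval_append_singleton _ _ _⟩

theorem exists_eval_of_zero {i j : ℕ}
    (h : ∀ S T, S.card = i → T.card = j →
      ∃ w, (subsetDFA hm hn hp).eval w = (⟨0, by omega⟩, S, T))
    (k : ℕ) (hk : k + 1 < m) (S : Finset (Fin n)) (T : Finset (Fin p)) (hS : S.card = i)
    (hT : T.card = j) : ∃ w, (subsetDFA hm hn hp).eval w = (⟨k, by omega⟩, S, T) := by
  have hn2 : 2 ≤ n := by omega
  induction k generalizing S with
  | zero => exact h S T hS hT
  | succ k ih =>
    have hc : (S.image transp).card = i := by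
      rw [card_image_of_injective _ (transp_involutive hn2).injective, hS]
    have h1 := exists_eval_step hm hn hp ABC.a (ih (by omega) (S.image transp) hc)
    rwa [step_a hm hn hp (q' := ⟨k + 1, by omega⟩) rfl (by simp only; omega),
      image_transp_image_transp hn2] at h1

theorem exists_eval_of_last {i j : ℕ} (hi : 0 < i) (hj : 0 < j)
    (h : ∀ (S : Finset (Fin n)) (T : Finset (Fin p)), S.card = i → T.card = j →
      ⟨0, by omega⟩ ∈ S → ⟨0, by omega⟩ ∈ T →
      ∃ w, (subsetDFA hm hn hp).eval w = (⟨m - 1, by omega⟩, S, T))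
    (S : Finset (Fin n)) (T : Finset (Fin p)) (hS : S.card = i) (hT : T.card = j) :
    ∃ w, (subsetDFA hm hn hp).eval w = (⟨0, by omega⟩, S, T) := by
  have hn2 : 2 ≤ n := by omega
  obtain ⟨s, hs⟩ := card_pos.mp (hS ▸ hi)
  obtain ⟨t, ht⟩ := card_pos.mp (hT ▸ hj)
  obtain ⟨g, hg, hgs, hgt⟩ := exists_loop_apply_eq hm hn hp s ⟨1, by omega⟩ t ⟨0, by omega⟩
  obtain ⟨u, hu⟩ := (loopSubgroup hm hn hp).inv_mem hg
  have h1 := h ((S.image g.1).image transp) (T.image g.2)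
    (by rw [card_image_of_injective _ (transp_involutive hn2).injective,
      card_image_of_injective _ g.1.injective, hS])
    (by rw [card_image_of_injective _ g.2.injective, hT])
    (by
      rw [mem_image]
      exact ⟨_, mem_image_of_mem _ hs, by ext; rw [hgs, val_transp hn2]; rfl⟩)
    (by rw [← hgt]; exact mem_image_of_mem _ ht)
  obtain ⟨w, hw⟩ := exists_eval_step hm hn hp ABC.a h1
  rw [step_a_of_last hm hn hp (q' := ⟨0, by omega⟩) (by simp only; omega) rfl,
    image_transp_image_transp hn2] at hw
  refine ⟨w ++ u, ?_⟩
  rw [DFA.eval] at hw ⊢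
  rw [DFA.evalFrom_of_append, hw, hu, image_image, image_image]
  have e1 : ⇑(g⁻¹).1 ∘ ⇑g.1 = id := funext fun x => g.1.symm_apply_apply x
  have e2 : ⇑(g⁻¹).2 ∘ ⇑g.2 = id := funext fun x => g.2.symm_apply_apply x
  rw [e1, e2, image_id, image_id]

theorem exists_eval_empty (k : ℕ) (hk : k + 1 < m) :
    ∃ w, (subsetDFA hm hn hp).eval w = (⟨k, by omega⟩, ∅, ∅) := by
  refine exists_eval_of_zero hm hn hp (i := 0) (j := 0) ?_ k hk ∅ ∅ rfl rfl
  intro S T hS hT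
  rw [card_eq_zero.mp hS, card_eq_zero.mp hT]
  exact ⟨[], rfl⟩

theorem exists_eval_last_of_lt {i j : ℕ}
    (h : ∀ S T, S.Nonempty → T.Nonempty → S.card + T.card < i + j →
      ∃ w, (subsetDFA hm hn hp).eval w = (⟨0, by omega⟩, S, T))
    (S : Finset (Fin n)) (T : Finset (Fin p)) (hS : S.card = i) (hT : T.card = j)
    (hS0 : ⟨0, by omega⟩ ∈ S) (hT0 : ⟨0, by omega⟩ ∈ T) :
    ∃ w, (subsetDFA hm hn hp).eval w = (⟨m - 1, by omega⟩, S, T) := by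
  have hn2 : 2 ≤ n := by omega
  have key : ∀ S' T', insert ⟨0, by omega⟩ S' = S → insert ⟨0, by omega⟩ T' = T →
      (∃ w, (subsetDFA hm hn hp).eval w = (⟨m - 2, by omega⟩, S'.image transp, T')) →
      ∃ w, (subsetDFA hm hn hp).eval w = (⟨m - 1, by omega⟩, S, T) := by
    intro S' T' hS' hT' h'
    have h1 := exists_eval_step hm hn hp ABC.a h'
    rwa [step_a_to_last hm hn hp (q' := ⟨m - 1, by omega⟩) (by simp only; omega)
      (by simp only; omega), image_transp_image_transp hn2, hS', hT'] at h1
  have key2 : ∀ S' T', insert ⟨0, by omega⟩ S' = S → insert ⟨0, by omega⟩ T' = T →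
      S'.Nonempty → T'.Nonempty → S'.card + T'.card < i + j →
      ∃ w, (subsetDFA hm hn hp).eval w = (⟨m - 1, by omega⟩, S, T) := by
    intro S' T' hS' hT' hSn hTn hlt
    refine key S' T' hS' hT' (exists_eval_of_zero hm hn hp (i := S'.card) (j := T'.card)
      ?_ _ (by omega) _ _ (card_image_of_injective _ (transp_involutive hn2).injective) rfl)
    intro S'' T'' hS'' hT''
    refine h S'' T'' ?_ ?_ (by omega)
    · rwa [← card_pos, hS'', card_pos]
    · rwa [← card_pos, hT'', card_pos]
  have c1 := card_erase_add_one hS0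
  have c2 := card_erase_add_one hT0
  rcases (S.erase ⟨0, by omega⟩).eq_empty_or_nonempty with h1 | h1
  · rcases (T.erase ⟨0, by omega⟩).eq_empty_or_nonempty with h2 | h2
    · refine key ∅ ∅ ?_ ?_ ?_
      · rw [← h1, insert_erase hS0]
      · rw [← h2, insert_erase hT0]
      · rw [image_empty]
        exact exists_eval_empty hm hn hp _ (by omega)
    · exact key2 S _ (insert_eq_of_mem hS0) (insert_erase hT0) ⟨_, hS0⟩ h2 (by omega)
  · exact key2 _ T (insert_erase hS0) (insert_eq_of_mem hT0) h1 ⟨_, hT0⟩ (by omega)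

theorem exists_eval_zero (S : Finset (Fin n)) (T : Finset (Fin p)) (hS : S.Nonempty)
    (hT : T.Nonempty) : ∃ w, (subsetDFA hm hn hp).eval w = (⟨0, by omega⟩, S, T) := by
  induction hk : S.card + T.card using Nat.strong_induction_on generalizing S T with
  | _ k ih =>
    refine exists_eval_of_last hm hn hp (card_pos.mpr hS) (card_pos.mpr hT) ?_ S T rfl rfl
    refine fun S' T' hS' hT' => exists_eval_last_of_lt hm hn hp ?_ S' T' hS' hT'
    exact fun S'' T'' hS'' hT'' hlt => ih _ (hk ▸ hlt) S'' T'' hS'' hT'' rfl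

/-- The reachable states of the subset automaton. -/
def reachableStates : Finset (Fin m × Finset (Fin n) × Finset (Fin p)) :=
  ({⟨m - 1, by omega⟩}ᶜ : Finset (Fin m)) ×ˢ ({(∅, ∅)} ∪
      ({∅}ᶜ : Finset (Finset (Fin n))) ×ˢ ({∅}ᶜ : Finset (Finset (Fin p)))) ∪
    ({⟨m - 1, by omega⟩} : Finset (Fin m)) ×ˢ (Icc {⟨0, by omega⟩} univ ×ˢ Icc {⟨0, by omega⟩} univ)

theorem mem_reachableStates : (q, S, T) ∈ reachableStates hm hn hp ↔
    (q.val + 1 ≠ m ∧ (S = ∅ ↔ T = ∅)) ∨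
      (q.val + 1 = m ∧ ⟨0, by omega⟩ ∈ S ∧ ⟨0, by omega⟩ ∈ T) := by
  have h : q = ⟨m - 1, by omega⟩ ↔ q.val + 1 = m := by
    rw [Fin.ext_iff]
    simp only
    omega
  simp only [reachableStates, mem_union, mem_product, mem_compl, mem_singleton, h, mem_Icc,
    Prod.mk.injEq, singleton_subset_iff, subset_univ, and_true]
  tauto

theorem card_reachableStates : (reachableStates hm hn hp).card =
    (m - 1) * (2 ^ (n + p) - 2 ^ n - 2 ^ p + 2) + 2 ^ (n + p - 2) := by
  rw [reachableStates, card_union_of_disjoint, card_product, card_product, card_product,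
    card_union_of_disjoint, card_product, card_Icc_finset (subset_univ _),
    card_Icc_finset (subset_univ _), card_compl, card_compl, card_compl]
  · simp only [card_singleton, card_univ, Fintype.card_fin, Fintype.card_finset]
    have e1 : 1 + (2 ^ n - 1) * (2 ^ p - 1) = 2 ^ (n + p) - 2 ^ n - 2 ^ p + 2 := by
      have hn1 : 3 ≤ 2 ^ n := hn.trans Nat.lt_two_pow_self
      have hp1 : 3 ≤ 2 ^ p := hp.trans Nat.lt_two_pow_self
      rw [pow_add]
      obtain ⟨x, hx⟩ := Nat.exists_eq_add_of_le hn1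
      obtain ⟨y, hy⟩ := Nat.exists_eq_add_of_le hp1
      rw [hx, hy, show 3 + x - 1 = x + 2 by omega, show 3 + y - 1 = y + 2 by omega]
      ring_nf
      omega
    rw [e1, one_mul, ← pow_add, show n - 1 + (p - 1) = n + p - 2 by omega]
  · rw [disjoint_left]
    simp
  · exact disjoint_product.mpr (Or.inl (disjoint_left.mpr fun _ h => mem_compl.mp h))

theorem exists_eval_of_mem_reachableStates (h : (q, S, T) ∈ reachableStates hm hn hp) :
    ∃ w, (subsetDFA hm hn hp).eval w = (q, S, T) := by
  rw [mem_reachableStates] at h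
  rcases h with ⟨hq, h⟩ | ⟨hq, hS, hT⟩
  · rcases S.eq_empty_or_nonempty with rfl | hS
    · rw [h.mp rfl]
      exact exists_eval_empty hm hn hp q (by omega)
    · have hT : T.Nonempty := by
        rw [nonempty_iff_ne_empty] at hS ⊢
        exact fun h' => hS (h.mpr h')
      refine exists_eval_of_zero hm hn hp ?_ q (by omega) S T rfl rfl
      intro S' T' hS' hT'
      refine exists_eval_zero hm hn hp S' T' ?_ ?_
      · rwa [← card_pos, hS', card_pos]
      · rwa [← card_pos, hT', card_pos]
  · have hl : q = ⟨m - 1, by omega⟩ := Fin.ext (by simp only; omega)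
    rw [hl]
    exact exists_eval_last_of_lt hm hn hp
      (fun S' T' hS' hT' _ => exists_eval_zero hm hn hp S' T' hS' hT') S T rfl rfl hS hT

theorem step_mem_reachableStates {s : Fin m × Finset (Fin n) × Finset (Fin p)}
    (hs : s ∈ reachableStates hm hn hp) (x : ABC) :
    (subsetDFA hm hn hp).step s x ∈ reachableStates hm hn hp := by
  obtain ⟨q, S, T⟩ := s
  by_cases h : ((XA m (by omega)).step q x).val + 1 = m
  · rw [step_of_eq hm hn hp rfl h, mem_reachableStates]
    exact Or.inr ⟨h, mem_insert_self _ _, mem_insert_self _ _⟩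
  · rw [step_of_ne hm hn hp rfl h, mem_reachableStates]
    refine Or.inl ⟨h, ?_⟩
    rw [mem_reachableStates] at hs
    rw [image_eq_empty, image_eq_empty]
    rcases hs with hs | hs
    · exact hs.2
    · exact iff_of_false (ne_empty_of_mem hs.2.1) (ne_empty_of_mem hs.2.2)

theorem exists_word_iff_mem_fst (s : Fin n) : ∃ w, ∀ S T,
    (subsetDFA hm hn hp).evalFrom (⟨0, by omega⟩, S, T) w ∈ (subsetDFA hm hn hp).accept ↔
      s ∈ S := by
  obtain ⟨g, ⟨u, hu⟩, hg, -⟩ :=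
    exists_loop_apply_eq hm hn hp s ⟨2, by omega⟩ ⟨0, by omega⟩ ⟨0, by omega⟩
  obtain ⟨g', ⟨v, hv⟩, hg1, hg2⟩ :=
    exists_loop_apply_eq hm hn hp ⟨2, by omega⟩ ⟨n - 1, by omega⟩ ⟨1, by omega⟩ ⟨p - 1, by omega⟩
  refine ⟨u ++ ABC.c :: v, fun S T => ?_⟩
  rw [DFA.evalFrom_of_append, hu, DFA.evalFrom_cons, step_c hm hn hp (by simp only; omega), hv,
    mem_subsetDFA_accept]
  simp only
  rw [← hg1, ← hg2, g'.1.injective.mem_finset_image, g'.2.injective.mem_finset_image]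
  have h1 : ∀ i : Fin n, contr i = ⟨2, by omega⟩ ↔ i = ⟨2, by omega⟩ :=
    fun i => contr_eq_iff le_rfl
  have h2 : ∀ i : Fin p, contr i ≠ ⟨1, by omega⟩ := fun i => contr_ne rfl
  simp only [mem_image, h1, h2, and_false, exists_false, or_false, exists_eq_right]
  rw [← hg]
  simp

theorem exists_word_iff_mem_snd (t : Fin p) : ∃ w, ∀ S T,
    (subsetDFA hm hn hp).evalFrom (⟨0, by omega⟩, S, T) w ∈ (subsetDFA hm hn hp).accept ↔
      t ∈ T := by
  obtain ⟨g, ⟨u, hu⟩, -, hg⟩ :=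
    exists_loop_apply_eq hm hn hp ⟨0, by omega⟩ ⟨0, by omega⟩ t ⟨2, by omega⟩
  obtain ⟨g', ⟨v, hv⟩, hg1, hg2⟩ :=
    exists_loop_apply_eq hm hn hp ⟨1, by omega⟩ ⟨n - 1, by omega⟩ ⟨2, by omega⟩ ⟨p - 1, by omega⟩
  refine ⟨u ++ ABC.c :: v, fun S T => ?_⟩
  rw [DFA.evalFrom_of_append, hu, DFA.evalFrom_cons, step_c hm hn hp (by simp only; omega), hv,
    mem_subsetDFA_accept]
  simp only
  rw [← hg1, ← hg2, g'.1.injective.mem_finset_image, g'.2.injective.mem_finset_image]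
  have h1 : ∀ i : Fin p, contr i = ⟨2, by omega⟩ ↔ i = ⟨2, by omega⟩ :=
    fun i => contr_eq_iff le_rfl
  have h2 : ∀ i : Fin n, contr i ≠ ⟨1, by omega⟩ := fun i => contr_ne rfl
  simp only [mem_image, h1, h2, and_false, exists_false, false_or, exists_eq_right]
  rw [← hg]
  simp

variable {S' : Finset (Fin n)} {T' : Finset (Fin p)}

theorem distinguishable_zero (h : (S, T) ≠ (S', T')) :
    Distinguishable (subsetDFA hm hn hp) (⟨0, by omega⟩, S, T) (⟨0, by omega⟩, S', T') := by
  by_contra hd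
  simp only [Distinguishable, not_exists, not_not] at hd
  apply h
  congr 1
  · ext s
    obtain ⟨w, hw⟩ := exists_word_iff_mem_fst hm hn hp s
    rw [← hw S T, hd, hw]
  · ext t
    obtain ⟨w, hw⟩ := exists_word_iff_mem_snd hm hn hp t
    rw [← hw S T, hd, hw]

theorem image_pair_ne {f : Fin n → Fin n} {g : Fin p → Fin p} (hf : f.Injective)
    (hg : g.Injective) (h : (S, T) ≠ (S', T')) :
    (S.image f, T.image g) ≠ (S'.image f, T'.image g) := by
  contrapose! h
  rw [Prod.mk.injEq] at h ⊢
  exact ⟨image_injective hf h.1, image_injective hg h.2⟩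

theorem distinguishable_last (hq : q.val + 1 = m) (h : (S, T) ≠ (S', T')) :
    Distinguishable (subsetDFA hm hn hp) (q, S, T) (q, S', T') := by
  apply Distinguishable.of_step ABC.a
  rw [step_a_of_last hm hn hp (q' := ⟨0, by omega⟩) hq rfl,
    step_a_of_last hm hn hp (q' := ⟨0, by omega⟩) hq rfl]
  apply distinguishable_zero
  simpa using image_pair_ne (transp_involutive (by omega)).injective Function.injective_id h

/-- A difference surviving the insertion of `0` on entering the final state of the first
automaton. -/
theorem distinguishable_of_ne (hq : q.val + 2 = m)
    (h : (∃ s : Fin n, s.val ≠ 1 ∧ ¬(s ∈ S ↔ s ∈ S')) ∨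
      ∃ t : Fin p, t.val ≠ 0 ∧ ¬(t ∈ T ↔ t ∈ T')) :
    Distinguishable (subsetDFA hm hn hp) (q, S, T) (q, S', T') := by
  have hn2 : 2 ≤ n := by omega
  apply Distinguishable.of_step ABC.a
  rw [step_a_to_last hm hn hp (q' := ⟨m - 1, by omega⟩) (by simp only; omega) (by simp only; omega),
    step_a_to_last hm hn hp (q' := ⟨m - 1, by omega⟩) (by simp only; omega) (by simp only; omega)]
  apply distinguishable_last hm hn hp (by simp only; omega)
  intro he
  rw [Prod.mk.injEq, Finset.ext_iff, Finset.ext_iff] at he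
  rcases h with ⟨s, hs, h⟩ | ⟨t, ht, h⟩
  · apply h
    have h0 : transp s ≠ ⟨0, by omega⟩ := by
      intro h0
      have h1 := congrArg Fin.val h0
      rw [val_transp hn2] at h1
      split_ifs at h1
      exact absurd h1 ‹_›
    have h1 := he.1 (transp s)
    rwa [mem_insert, mem_insert, (transp_involutive hn2).injective.mem_finset_image,
      (transp_involutive hn2).injective.mem_finset_image, or_iff_right h0, or_iff_right h0] at h1
  · apply h
    have h0 : t ≠ ⟨0, by omega⟩ := by
      rwa [Ne, Fin.ext_iff]
    have h1 := he.2 t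
    rwa [mem_insert, mem_insert, or_iff_right h0, or_iff_right h0] at h1

theorem distinguishable_of_two_le (k : ℕ) (hq : q.val + 2 + k = m) (hq2 : 2 ≤ q.val)
    (h : (S, T) ≠ (S', T')) :
    Distinguishable (subsetDFA hm hn hp) (q, S, T) (q, S', T') := by
  induction k generalizing q S S' with
  | zero =>
    by_cases hgood : (∃ s : Fin n, s.val ≠ 1 ∧ ¬(s ∈ S ↔ s ∈ S')) ∨
        ∃ t : Fin p, t.val ≠ 0 ∧ ¬(t ∈ T ↔ t ∈ T')
    · exact distinguishable_of_ne hm hn hp hq hgood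
    · apply Distinguishable.of_step ABC.b
      rw [step_b_of_two_le hm hn hp hq2 (by omega), step_b_of_two_le hm hn hp hq2 (by omega)]
      apply distinguishable_of_ne hm hn hp hq
      by_contra hgood'
      push Not at hgood hgood'
      apply h
      rw [Prod.mk.injEq, Finset.ext_iff, Finset.ext_iff]
      refine ⟨fun s => ?_, fun t => ?_⟩
      · by_cases hs : s.val = 1
        · have h1 := hgood'.1 (cyc s) (by rw [val_cyc]; split_ifs <;> omega)
          rwa [cyc_injective.mem_finset_image, cyc_injective.mem_finset_image] at h1
        · exact hgood.1 s hs
      · by_cases ht : t.val = 0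
        · have h1 := hgood'.2 (cyc t) (by rw [val_cyc]; split_ifs <;> omega)
          rwa [cyc_injective.mem_finset_image, cyc_injective.mem_finset_image] at h1
        · exact hgood.2 t ht
  | succ k ih =>
    apply Distinguishable.of_step ABC.a
    rw [step_a hm hn hp (q' := ⟨q.val + 1, by omega⟩) rfl (by simp only; omega),
      step_a hm hn hp (q' := ⟨q.val + 1, by omega⟩) rfl (by simp only; omega)]
    refine ih (by simp only; omega) (by simp only; omega) ?_
    simpa using image_pair_ne (transp_involutive (by omega)).injective Function.injective_id h

theorem distinguishable_of_pair_ne (h : (S, T) ≠ (S', T')) :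
    Distinguishable (subsetDFA hm hn hp) (q, S, T) (q, S', T') := by
  rcases (by omega : q.val = 0 ∨ q.val = 1 ∨ 2 ≤ q.val) with hq | hq | hq
  · rw [show q = ⟨0, by omega⟩ from Fin.ext hq]
    exact distinguishable_zero hm hn hp h
  · apply Distinguishable.of_step ABC.b
    rw [step_b_of_le_one hm hn hp (q' := ⟨0, by omega⟩) hq.le (by simp only; omega),
      step_b_of_le_one hm hn hp (q' := ⟨0, by omega⟩) hq.le (by simp only; omega)]
    exact distinguishable_zero hm hn hp (image_pair_ne cyc_injective cyc_injective h)
  · by_cases hl : q.val + 1 = m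
    · exact distinguishable_last hm hn hp hl h
    · exact distinguishable_of_two_le hm hn hp (m - 2 - q.val) (by omega) hq h

theorem exists_step_b_eq (h : q.val + 1 ≠ m) : ∃ q' : Fin m, q'.val + 1 ≠ m ∧
    ∀ S T, (subsetDFA hm hn hp).step (q, S, T) ABC.b = (q', S.image cyc, T.image cyc) := by
  by_cases hq : 2 ≤ q.val
  · exact ⟨q, h, fun S T => step_b_of_two_le hm hn hp hq h⟩
  · exact ⟨⟨1 - q.val, by omega⟩, by simp only; omega,
      fun S T => step_b_of_le_one hm hn hp (by omega) rfl⟩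

/-- Rotating by `b` fills the last component on the left while keeping singletons on the right. -/
theorem distinguishable_of_rotation (d j : ℕ) (hd : j + d = n * p) (hq : q.val + 1 = m)
    (hq' : q'.val + 1 ≠ m) (hS' : ∀ s ∈ S', s.val = j % n) (hT' : ∀ t ∈ T', t.val = j % p)
    (hT : ∀ t : Fin p, t.val ≤ j → t ∈ T) :
    Distinguishable (subsetDFA hm hn hp) (q, S, T) (q', S', T') := by
  induction d generalizing j q' S T S' T' with
  | zero =>
    obtain rfl : j = n * p := hd
    refine ⟨[], fun h => ?_⟩
    rw [DFA.evalFrom_nil, DFA.evalFrom_nil, mem_subsetDFA_accept, mem_subsetDFA_accept] at h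
    rcases h.mp (Or.inr (hT _ (by simp only; nlinarith [Nat.sub_le p 1]))) with h1 | h1
    · have h2 := hS' _ h1
      rw [Nat.mul_mod_right] at h2
      simp only at h2
      omega
    · have h2 := hT' _ h1
      rw [Nat.mul_mod_left] at h2
      simp only at h2
      omega
  | succ d ih =>
    obtain ⟨q'', hq'', hstep⟩ := exists_step_b_eq hm hn hp hq'
    apply Distinguishable.of_step ABC.b
    rw [step_b_of_last hm hn hp hq, hstep]
    refine ih (j + 1) (by omega) hq'' ?_ ?_ ?_
    · intro s hs
      obtain ⟨i, hi, rfl⟩ := mem_image.mp hs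
      change (i.val + 1) % n = _
      rw [hS' i hi, Nat.mod_add_mod]
    · intro t ht
      obtain ⟨i, hi, rfl⟩ := mem_image.mp ht
      change (i.val + 1) % p = _
      rw [hT' i hi, Nat.mod_add_mod]
    · intro t ht
      rw [mem_insert, mem_image]
      by_cases h0 : t.val = 0
      · exact Or.inl (Fin.ext h0)
      · refine Or.inr ⟨⟨t.val - 1, by omega⟩, hT _ (by simp only; omega), ?_⟩
        ext
        rw [val_cyc_of_lt (by simp only; omega)]
        simp only
        omega

theorem val_contr_cyc {n : ℕ} {k : ℕ} {i : Fin n} (h : i.val = 0 ∨ k < i.val) :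
    (contr (cyc i)).val = 0 ∨ k + 1 < (contr (cyc i)).val := by
  rw [val_contr, val_cyc]
  split_ifs <;> omega

/-- Iterating `bc` collapses both sets on the right to subsets of `{0}`. -/
theorem distinguishable_of_collapse (d k : ℕ) (hd : k + d = n + p) (hq : q.val + 1 = m)
    (hq' : q'.val + 1 ≠ m) (hS' : ∀ s ∈ S', s.val = 0 ∨ k < s.val)
    (hT' : ∀ t ∈ T', t.val = 0 ∨ k < t.val) (hT : ⟨0, by omega⟩ ∈ T) :
    Distinguishable (subsetDFA hm hn hp) (q, S, T) (q', S', T') := by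
  induction d generalizing k q' S T S' T' with
  | zero =>
    refine distinguishable_of_rotation hm hn hp (n * p) 0 (by omega) hq hq' ?_ ?_ ?_
    · intro s hs
      rw [Nat.zero_mod]
      have := hS' s hs
      omega
    · intro t ht
      rw [Nat.zero_mod]
      have := hT' t ht
      omega
    · intro t ht
      rw [show t = ⟨0, by omega⟩ from Fin.ext (Nat.le_zero.mp ht)]
      exact hT
  | succ d ih =>
    obtain ⟨q'', hq'', hstep⟩ := exists_step_b_eq hm hn hp hq'
    apply Distinguishable.of_step ABC.b
    apply Distinguishable.of_step ABC.c
    rw [step_b_of_last hm hn hp hq, hstep, step_c_of_last hm hn hp hq, step_c hm hn hp hq'',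
      image_image, image_image]
    refine ih (k + 1) (by omega) hq'' ?_ ?_ (mem_insert_self _ _)
    · intro s hs
      obtain ⟨i, hi, rfl⟩ := mem_image.mp hs
      exact val_contr_cyc (hS' i hi)
    · intro t ht
      obtain ⟨i, hi, rfl⟩ := mem_image.mp ht
      exact val_contr_cyc (hT' i hi)

theorem distinguishable_of_lt (k : ℕ) (hk : q.val + 1 + k = m) (hlt : q'.val < q.val)
    (h : q.val + 1 = m → ⟨0, by omega⟩ ∈ T) :
    Distinguishable (subsetDFA hm hn hp) (q, S, T) (q', S', T') := by
  induction k generalizing q q' S T S' T' with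
  | zero =>
    exact distinguishable_of_collapse hm hn hp (n + p) 0 (by omega) hk (by omega)
      (fun s _ => Nat.eq_zero_or_pos _) (fun t _ => Nat.eq_zero_or_pos _) (h hk)
  | succ k ih =>
    apply Distinguishable.of_step ABC.a
    rw [step_a hm hn hp (q := q') (q' := ⟨q'.val + 1, by omega⟩) rfl (by simp only; omega)]
    by_cases hq : q.val + 2 = m
    · rw [step_a_to_last hm hn hp (q' := ⟨q.val + 1, by omega⟩) rfl hq]
      exact ih (by simp only; omega) (by simpa using hlt) (fun _ => mem_insert_self _ _)
    · rw [step_a hm hn hp (q' := ⟨q.val + 1, by omega⟩) rfl hq]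
      exact ih (by simp only; omega) (by simpa using hlt) (fun h' => absurd h' hq)

theorem distinguishable_of_mem_reachableStates
    {s t : Fin m × Finset (Fin n) × Finset (Fin p)} (hs : s ∈ reachableStates hm hn hp)
    (ht : t ∈ reachableStates hm hn hp) (h : s ≠ t) :
    Distinguishable (subsetDFA hm hn hp) s t := by
  obtain ⟨q, S, T⟩ := s
  obtain ⟨q', S', T'⟩ := t
  rw [mem_reachableStates] at hs ht
  rcases lt_trichotomy q q' with hlt | rfl | hlt
  · exact (distinguishable_of_lt hm hn hp (m - 1 - q'.val) (by omega) hlt (by tauto)).symm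
  · exact distinguishable_of_pair_ne hm hn hp (fun h' => h (by rw [h']))
  · exact distinguishable_of_lt hm hn hp (m - 1 - q.val) (by omega) hlt (by tauto)

end Steps

theorem statement11 (m n p : ℕ) (hm : 3 ≤ m) (hn : 3 ≤ n) (hp : 3 ≤ p) :
    sc ((XA m (by omega)).accepts * ((XB n (by omega)).accepts ⊔ (XC p (by omega)).accepts)) =
      (m - 1) * (2 ^ (n + p) - 2 ^ n - 2 ^ p + 2) + 2 ^ (n + p - 2) := by
  rw [← subsetDFA_accepts hm hn hp, ← card_reachableStates hm hn hp]
  refine sc_eq_card _ _ ?_ (fun s hs x => step_mem_reachableStates hm hn hp hs x)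
    (fun s hs => exists_eval_of_mem_reachableStates hm hn hp hs)
    (fun s hs t ht h => distinguishable_of_mem_reachableStates hm hn hp hs ht h)
  refine (mem_reachableStates hm hn hp).mpr (Or.inl ⟨?_, iff_of_true rfl rfl⟩)
  change 0 + 1 ≠ m
  omega
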